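/- arXiv:1811.07142 — 3 statements merged into one kernel-verified Lean document; each statement's English description precedes it below -/
import Mathlib

section
/- Let Var be a finite set with a wildcard element * and let B ∈ ℕ. The set of all B-gap-bounded named gaps over Var (together with all named gaps whose value is nreg) is well-quasi-ordered by ⊴. -/
universe u v w

/-- A gap quadruple `(lw, ls, uw, us)` with `lw, ls ∈ ℕ` and `uw, us ∈ ℕ ∪ {∞}`. -/
structure GapVal where
  lw : ℕ
  ls : ℕ
  uw : ℕ∞
  us : ℕ∞

/-- Well-formedness of a gap quadruple: either both upper bounds are finite,
or both are `∞`. -/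
def GapVal.WF (g : GapVal) : Prop :=
  (g.uw ≠ ⊤ ∧ g.us ≠ ⊤) ∨ (g.uw = ⊤ ∧ g.us = ⊤)

/-- A named gap over `Var`: a variable together with either `nreg`
(modelled by `none`) or a gap quadruple. -/
abbrev NamedGap (Var : Type u) := Var × Option GapVal

/-- A gap quadruple is free if both its upper bounds are `∞`. -/
def GapVal.Free (g : GapVal) : Prop := g.uw = ⊤ ∧ g.us = ⊤

/-- A gap quadruple is `B`-gap-bounded if both its upper bounds are at most `B`. -/
def GapVal.Bounded (B : ℕ) (g : GapVal) : Prop := g.uw ≤ (B : ℕ∞) ∧ g.us ≤ (B : ℕ∞)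

/-- The order `⊴` on named gaps, where `star` is the wildcard element of `Var`. -/
def gapLe {Var : Type u} (star : Var) (a b : NamedGap Var) : Prop :=
  (a.1 ≠ b.1 → a.1 = star) ∧
  (a.2 = none ↔ b.2 = none) ∧
  ∀ v v' : GapVal, a.2 = some v → b.2 = some v' →
    v.lw ≤ v'.lw ∧ v.ls ≤ v'.ls ∧ v'.uw ≤ v.uw ∧ v'.us ≤ v.us

/-- A set of named gaps is `B`-good if each of its elements carrying a gap
quadruple is free or `B`-gap-bounded. -/
def GoodSet {Var : Type u} (B : ℕ) (G : Set (NamedGap Var)) : Prop :=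
  ∀ g ∈ G, ∀ v : GapVal, g.2 = some v → v.Free ∨ v.Bounded B

/-- `r` is a well-quasi-order on the subset `S`: every infinite sequence of
elements of `S` contains indices `i < j` with `r (f i) (f j)`. -/
def IsWQOOn {α : Type u} (S : Set α) (r : α → α → Prop) : Prop :=
  ∀ f : ℕ → α, (∀ n, f n ∈ S) → ∃ i j, i < j ∧ r (f i) (f j)

/-- A task state of dimension `K`. -/
abbrev TaskState (UnrSuff : Type u) (Var : Type v) (K : ℕ) :=
  UnrSuff × (Fin K → NamedGap Var)

/-- The order `≼` on task states, where `starU` and `star` are the wildcard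
elements of `UnrSuff` and `Var` respectively. -/
def taskLe {UnrSuff : Type u} {Var : Type v} (starU : UnrSuff) (star : Var) {K : ℕ}
    (a b : TaskState UnrSuff Var K) : Prop :=
  (a.1 ≠ b.1 → a.1 = starU) ∧ ∀ k, gapLe star (a.2 k) (b.2 k)

/-- `A ∀∃≼ B`: every element of `A` is `r`-below some element of `B`. -/
def forallExists {α : Type u} (r : α → α → Prop) (A B : Multiset α) : Prop :=
  ∀ a ∈ A, ∃ b ∈ B, r a b

/-- `A ∃∀≼ B`: every element of `B` is `r`-above some element of `A`. -/
def existsForall {α : Type u} (r : α → α → Prop) (A B : Multiset α) : Prop :=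
  ∀ b ∈ B, ∃ a ∈ A, r a b

/-- A configuration: finite sets of tasks and phasers (modelled as finite sets
of naturals), a Boolean valuation, control sequences, and phases.  In a phase
`(var, some (w, s))`, `w` is the wait value and `s` the signal value, while
`(var, none)` means the task is not registered to the phaser. -/
structure Config (BV : Type u) (Var : Type v) (UnrSuff : Type w) where
  T : Finset ℕ
  P : Finset ℕ
  bv : BV → Bool
  seq : ℕ → UnrSuff
  phase : ℕ → ℕ → Var × Option (ℕ × ℕ)

/-- A constraint: finite sets of tasks and phasers, a Boolean valuation with
wildcard (`none` is `*`), control sequences, named gaps, and environment gaps. -/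
structure Constraint (BV : Type u) (Var : Type v) (UnrSuff : Type w) where
  T : Finset ℕ
  P : Finset ℕ
  bv : BV → Option Bool
  seq : ℕ → UnrSuff
  gap : ℕ → ℕ → NamedGap Var
  egap : ℕ → ℕ × ℕ

/-- `c ⊨ φ`: the configuration `c` is denoted by the constraint `φ`.
The inequalities `lw ≤ l − w ≤ uw` and `ls ≤ s − l ≤ us` are rendered
additively (`w + lw ≤ l`, etc.) to avoid truncated subtraction issues. -/
def Denotes {BV : Type u} {Var : Type v} {UnrSuff : Type w} (star : Var) (starU : UnrSuff)
    (φ : Constraint BV Var UnrSuff) (c : Config BV Var UnrSuff) : Prop :=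
  (∀ b, φ.bv b ≠ some (c.bv b) → φ.bv b = none) ∧
  ∃ T1 ⊆ c.T, ∃ P1 ⊆ c.P, ∃ τ : ℕ → ℕ, ∃ π : ℕ → ℕ,
    T1.image τ = φ.T ∧ Set.InjOn π ↑P1 ∧ P1.image π = φ.P ∧
    (∀ t ∈ T1, φ.seq (τ t) ≠ c.seq t → φ.seq (τ t) = starU) ∧
    ∀ p ∈ P1, ∃ l : ℕ,
      (∀ t ∈ T1,
        ((c.phase t p).1 ≠ (φ.gap (τ t) (π p)).1 → (φ.gap (τ t) (π p)).1 = star) ∧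
        ((c.phase t p).2 = none ↔ (φ.gap (τ t) (π p)).2 = none) ∧
        (∀ w s : ℕ, ∀ v : GapVal, (c.phase t p).2 = some (w, s) →
          (φ.gap (τ t) (π p)).2 = some v →
          w + v.lw ≤ l ∧ ((l - w : ℕ) : ℕ∞) ≤ v.uw ∧
          l + v.ls ≤ s ∧ ((s - l : ℕ) : ℕ∞) ≤ v.us)) ∧
      (∀ t ∈ c.T, t ∉ T1 → ∀ w s : ℕ, (c.phase t p).2 = some (w, s) →
        w + (φ.egap (π p)).1 ≤ l ∧ l + (φ.egap (π p)).2 ≤ s)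

/-- The denotation `⟦φ⟧` of a constraint. -/
def Denotation {BV : Type u} {Var : Type v} {UnrSuff : Type w} (star : Var) (starU : UnrSuff)
    (φ : Constraint BV Var UnrSuff) : Set (Config BV Var UnrSuff) :=
  {c | Denotes star starU φ c}

/-- `φa ⊑ φb`: the constraint `φa` is entailed by the constraint `φb`. -/
def Entails {BV : Type u} {Var : Type v} {UnrSuff : Type w} (star : Var) (starU : UnrSuff)
    (φa φb : Constraint BV Var UnrSuff) : Prop :=
  (∀ b, φa.bv b ≠ φb.bv b → φa.bv b = none) ∧
  ∃ T1 ⊆ φb.T, ∃ P1 ⊆ φb.P, ∃ τ : ℕ → ℕ, ∃ π : ℕ → ℕ,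
    T1.image τ = φa.T ∧ Set.InjOn π ↑P1 ∧ P1.image π = φa.P ∧
    (∀ t ∈ T1, φa.seq (τ t) ≠ φb.seq t → φa.seq (τ t) = starU) ∧
    ∀ p ∈ P1,
      ((φa.egap (π p)).1 ≤ (φb.egap p).1 ∧ (φa.egap (π p)).2 ≤ (φb.egap p).2) ∧
      (∀ t ∈ T1, gapLe star (φa.gap (τ t) (π p)) (φb.gap t p)) ∧
      (∀ t ∈ φb.T, t ∉ T1 → ∀ v : GapVal, (φb.gap t p).2 = some v →
        (φa.egap (π p)).1 ≤ v.lw ∧ (φa.egap (π p)).2 ≤ v.ls)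

/-- A constraint is `B`-good if all the named gaps of its tasks/phasers
carrying a quadruple are free or `B`-gap-bounded. -/
def ConstraintBGood {BV : Type u} {Var : Type v} {UnrSuff : Type w} (B : ℕ)
    (φ : Constraint BV Var UnrSuff) : Prop :=
  ∀ t ∈ φ.T, ∀ p ∈ φ.P, ∀ v : GapVal, (φ.gap t p).2 = some v → v.Free ∨ v.Bounded B

/-- An encoding of a constraint: `L` task indices, `M` phaser indices. -/
structure Encoding (BV : Type u) (Var : Type v) (UnrSuff : Type w) where
  L : ℕ
  M : ℕ
  bv : BV → Option Bool
  acc : Fin L → UnrSuff × (Fin M → NamedGap Var)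
  env : Fin M → ℕ × ℕ

/-- `e` enumerates the finite set `S` (this corresponds to choosing a total
order on `S`, the element of index `i` being `e i`). -/
def IsEnum (S : Finset ℕ) (e : Fin S.card → ℕ) : Prop :=
  Function.Injective e ∧ ∀ i, e i ∈ S

/-- The encoding `⌈φ⌉` of a constraint `φ` with respect to enumerations
(total orders) `eT` of its tasks and `eP` of its phasers. -/
def encodingOf {BV : Type u} {Var : Type v} {UnrSuff : Type w}
    (φ : Constraint BV Var UnrSuff)
    (eT : Fin φ.T.card → ℕ) (eP : Fin φ.P.card → ℕ) : Encoding BV Var UnrSuff where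
  L := φ.T.card
  M := φ.P.card
  bv := φ.bv
  acc := fun i => (φ.seq (eT i), fun j => φ.gap (eT i) (eP j))
  env := fun j => φ.egap (eP j)

/-- The entailment relation `⊑ₑ` on encodings. -/
def EncEntails {BV : Type u} {Var : Type v} {UnrSuff : Type w} (star : Var) (starU : UnrSuff)
    (e e' : Encoding BV Var UnrSuff) : Prop :=
  (∀ b, e.bv b ≠ e'.bv b → e.bv b = none) ∧
  ∃ hM : e.M = e'.M, ∃ h : Fin e'.L → Fin e.L, Function.Surjective h ∧
    (∀ i : Fin e'.L,
      ((e.acc (h i)).1 ≠ (e'.acc i).1 → (e.acc (h i)).1 = starU) ∧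
      ∀ j : Fin e.M, gapLe star ((e.acc (h i)).2 j) ((e'.acc i).2 (Fin.cast hM j))) ∧
    (∀ j : Fin e.M, (e.env j).1 ≤ (e'.env (Fin.cast hM j)).1 ∧
      (e.env j).2 ≤ (e'.env (Fin.cast hM j)).2)

/-- An encoding is `B`-good if every named gap occurring in it and carrying a
quadruple is free or `B`-gap-bounded. -/
def EncodingBGood {BV : Type u} {Var : Type v} {UnrSuff : Type w} (B : ℕ)
    (e : Encoding BV Var UnrSuff) : Prop :=
  ∀ (i : Fin e.L) (j : Fin e.M) (v : GapVal),
    ((e.acc i).2 j).2 = some v → v.Free ∨ v.Bounded B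

/-- The part of a named gap that takes finitely many values on `B`-gap-bounded gaps: the variable
and the two upper bounds. -/
noncomputable def NamedGap.color {Var : Type u} (B : ℕ) (g : NamedGap Var) :
    Var × Option (Fin (B + 1) × Fin (B + 1)) :=
  (g.1, g.2.map fun v => (Fin.ofNat (B + 1) v.uw.toNat, Fin.ofNat (B + 1) v.us.toNat))

/-- The lower bounds of a named gap, `(0, 0)` if its value is `nreg`. -/
def NamedGap.lower {Var : Type u} (g : NamedGap Var) : ℕ × ℕ :=
  g.2.elim (0, 0) fun v => (v.lw, v.ls)

theorem ENat.eq_of_fin_ofNat_toNat_eq {B : ℕ} {m n : ℕ∞} (hm : m ≤ B) (hn : n ≤ B)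
    (h : Fin.ofNat (B + 1) m.toNat = Fin.ofNat (B + 1) n.toNat) : m = n := by
  lift m to ℕ using ne_top_of_le_ne_top (ENat.natCast_ne_top B) hm
  lift n to ℕ using ne_top_of_le_ne_top (ENat.natCast_ne_top B) hn
  rw [Nat.cast_le] at hm hn
  have h' := congrArg Fin.val h
  simp only [Fin.ofNat, ENat.toNat_natCast, Nat.mod_eq_of_lt (Nat.lt_succ_of_le hm),
    Nat.mod_eq_of_lt (Nat.lt_succ_of_le hn)] at h'
  rw [h']

theorem gapLe_of_color_eq {Var : Type u} (star : Var) {B : ℕ} {a b : NamedGap Var}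
    (ha : a.2 = none ∨ ∃ v : GapVal, a.2 = some v ∧ v.Bounded B)
    (hb : b.2 = none ∨ ∃ v : GapVal, b.2 = some v ∧ v.Bounded B)
    (hc : NamedGap.color B a = NamedGap.color B b)
    (hl : NamedGap.lower a ≤ NamedGap.lower b) : gapLe star a b := by
  obtain ⟨x, va⟩ := a
  obtain ⟨y, vb⟩ := b
  obtain ⟨hxy, hv⟩ := Prod.mk.inj hc
  refine ⟨fun h => absurd hxy h, ?_, ?_⟩
  · simpa using congrArg (· = none) hv
  · rintro v v' rfl rfl
    obtain ⟨hvw, hvs⟩ : v.Bounded B := by simpa using ha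
    obtain ⟨hvw', hvs'⟩ : v'.Bounded B := by simpa using hb
    obtain ⟨hw, hs⟩ := Prod.mk.inj (Option.some.inj hv)
    exact ⟨hl.1, hl.2, (ENat.eq_of_fin_ofNat_toNat_eq hvw hvw' hw).ge,
      (ENat.eq_of_fin_ofNat_toNat_eq hvs hvs' hs).ge⟩

/-- The set of all `B`-gap-bounded named gaps, together with all
named gaps whose value is `nreg`, is well-quasi-ordered by `⊴`. -/
theorem bounded_isWQO_gapLe {Var : Type u} [Fintype Var] (star : Var) (B : ℕ) :
    IsWQOOn {g : NamedGap Var | g.2 = none ∨ ∃ v : GapVal, g.2 = some v ∧ v.Bounded B}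
      (gapLe star) := by
  intro f hf
  have hwqo := (Finite.wellQuasiOrdered
    (Eq : Var × Option (Fin (B + 1) × Fin (B + 1)) → _ → Prop)).prod
      (wellQuasiOrdered_le (α := ℕ × ℕ))
  obtain ⟨i, j, hij, hc, hl⟩ := hwqo fun n => (NamedGap.color B (f n), NamedGap.lower (f n))
  exact ⟨i, j, hij, gapLe_of_color_eq star (hf i) (hf j) hc hl⟩
end

section
/- Let K, B ∈ ℕ and let E be a set of constraint encodings that is K-dimension-bounded (every encoding in E has dimension at most K) and B-good (every constraint encoded by an element of E is B-good). Then the relation ⊑_e is a well-quasi-order on E. -/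
universe u v w

/-- `A` is below `B` in the Smyth quasi-order: every element of `B` is above one of `A`. -/
def List.SmythRel {α : Type*} (r : α → α → Prop) (A B : List α) : Prop :=
  ∀ b ∈ B, ∃ a ∈ A, r a b

instance List.SmythRel.isPreorder {α : Type*} (r : α → α → Prop) [IsPreorder α r] :
    IsPreorder (List α) (List.SmythRel r) where
  refl _ b hb := ⟨b, hb, refl_of r b⟩
  trans _ _ _ hAB hBC c hc := by
    obtain ⟨b, hb, hbc⟩ := hBC c hc
    obtain ⟨a, ha, hab⟩ := hAB b hb
    exact ⟨a, ha, trans_of r hab hbc⟩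

/-- Higman's lemma for relations on a whole type. -/
theorem WellQuasiOrdered.sublistForall₂ {α : Type*} {r : α → α → Prop} [IsPreorder α r]
    (hr : WellQuasiOrdered r) : WellQuasiOrdered (List.SublistForall₂ r) := by
  have h := Set.PartiallyWellOrderedOn.partiallyWellOrderedOn_sublistForall₂ r
    (Set.partiallyWellOrderedOn_of_wellQuasiOrdered hr Set.univ)
  simpa [Set.partiallyWellOrderedOn_univ_iff] using h

theorem WellQuasiOrdered.comap {α β : Type*} {r : β → β → Prop} (hr : WellQuasiOrdered r)
    (f : α → β) : WellQuasiOrdered fun a b => r (f a) (f b) :=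
  fun s => hr (f ∘ s)

/-- The complement of a finitely generated upper set of `ι → ℕ` is a finite union of boxes. -/
theorem exists_list_forall_not_le_iff {ι : Type*} [Finite ι] (A : List (ι → ℕ)) :
    ∃ V : List (ι → ℕ∞), ∀ b : ι → ℕ,
      (∀ a ∈ A, ¬ a ≤ b) ↔ ∃ v ∈ V, ∀ i, (b i : ℕ∞) < v i := by
  classical
  have := Fintype.ofFinite ι
  induction A with
  | nil => exact ⟨[⊤], by simp⟩
  | cons a A ih =>
    obtain ⟨V, hV⟩ := ih
    refine ⟨V.flatMap fun v => Finset.univ.toList.map fun i =>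
      Function.update v i (min (v i) (a i)), fun b => ?_⟩
    rw [List.forall_mem_cons, hV]
    simp only [List.mem_flatMap, List.mem_map, Finset.mem_toList, Finset.mem_univ, true_and,
      Pi.le_def, not_forall, not_le]
    constructor
    · rintro ⟨⟨i, hi⟩, v, hv, hb⟩
      refine ⟨_, ⟨v, hv, i, rfl⟩, fun j => ?_⟩
      by_cases h : j = i
      · subst h
        simpa using ⟨hb j, hi⟩
      · simpa [h] using hb j
    · rintro ⟨_, ⟨v, hv, i, rfl⟩, hb⟩
      refine ⟨⟨i, ?_⟩, v, hv, fun j => ?_⟩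
      · have := hb i
        simp only [Function.update_self, lt_min_iff, Nat.cast_lt] at this
        exact this.2
      · have := hb j
        by_cases h : j = i
        · subst h
          simp only [Function.update_self, lt_min_iff] at this
          exact this.1
        · simpa [h] using this

/-- Finite subsets of `ι → ℕ` are well-quasi-ordered by the Smyth quasi-order. -/
theorem wellQuasiOrdered_smythRel_le {ι : Type*} [Finite ι] :
    WellQuasiOrdered (List.SmythRel fun a b : ι → ℕ => a ≤ b) := by
  choose V hV using exists_list_forall_not_le_iff (ι := ι)
  intro s
  obtain ⟨m, n, hmn, h⟩ :=
    (wellQuasiOrdered_le (α := ι → ℕ∞)).sublistForall₂.comap V s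
  refine ⟨m, n, hmn, fun b hb => ?_⟩
  by_contra! hne
  obtain ⟨v, hv, hbv⟩ := (hV (s m) b).1 hne
  obtain ⟨l, hl, hsub⟩ := List.sublistForall₂_iff.1 h
  obtain ⟨i, hi, rfl⟩ := List.getElem_of_mem hv
  have hi' : i < l.length := hl.length_eq ▸ hi
  have hle := List.Forall₂.get hl hi hi'
  exact (hV (s n) b).2 ⟨l[i], hsub.subset (List.getElem_mem hi'),
    fun j => (hbv j).trans_le (hle j)⟩ b hb le_rfl

/-- The order on labelled vectors: equal labels and componentwise comparison. -/
def LabelledLe {F ι : Type*} (a b : F × (ι → ℕ)) : Prop := a.1 = b.1 ∧ a.2 ≤ b.2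

instance LabelledLe.isPreorder {F ι : Type*} : IsPreorder (F × (ι → ℕ)) LabelledLe where
  refl _ := ⟨rfl, le_rfl⟩
  trans _ _ _ h h' := ⟨h.1.trans h'.1, h.2.trans h'.2⟩

theorem wellQuasiOrdered_labelledLe {F ι : Type*} [Finite F] [Finite ι] :
    WellQuasiOrdered (LabelledLe (F := F) (ι := ι)) :=
  (Finite.wellQuasiOrdered (α := F) (· = ·)).prod wellQuasiOrdered_le

theorem wellQuasiOrdered_smythRel_labelledLe {F ι : Type*} [Finite F] [Finite ι] :
    WellQuasiOrdered (List.SmythRel (LabelledLe (F := F) (ι := ι))) := by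
  classical
  intro s
  obtain ⟨m, n, hmn, h⟩ := (WellQuasiOrdered.pi fun _ : F =>
    wellQuasiOrdered_smythRel_le (ι := ι)).comap
      (fun (A : List (F × (ι → ℕ))) f => (A.filter (·.1 = f)).map Prod.snd) s
  refine ⟨m, n, hmn, fun b hb => ?_⟩
  obtain ⟨x, hx, hxb⟩ := h b.1 b.2 (by simpa using hb)
  simp only [List.mem_map, List.mem_filter, decide_eq_true_eq] at hx
  obtain ⟨a, ⟨ha, hab⟩, rfl⟩ := hx
  exact ⟨a, ha, hab, hxb⟩

/-- `B` maps onto `A` by a map all of whose values are below their arguments. -/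
def List.SurjRel {α : Type*} (r : α → α → Prop) (A B : List α) : Prop :=
  ∃ h : Fin B.length → Fin A.length, Function.Surjective h ∧ ∀ i, r (A.get (h i)) (B.get i)

theorem List.SublistForall₂.surjRel {α : Type*} {r : α → α → Prop} {A B : List α}
    (h : List.SublistForall₂ r A B) (hs : List.SmythRel r A B) : List.SurjRel r A B := by
  classical
  obtain ⟨l, hl, hsub⟩ := List.sublistForall₂_iff.1 h
  obtain ⟨g, hg⟩ := List.sublist_iff_exists_fin_orderEmbedding_get_eq.1 hsub
  have hget : ∀ j, ∃ i, r (A.get i) (B.get j) := fun j => by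
    obtain ⟨a, ha, hab⟩ := hs (B.get j) (List.get_mem B j)
    obtain ⟨i, rfl⟩ := List.get_of_mem ha
    exact ⟨i, hab⟩
  choose k hk using hget
  let f : Fin A.length → Fin B.length := fun i => g (i.cast hl.length_eq)
  have hf : Function.Injective f := fun i j hij => by
    simpa [f, Fin.ext_iff] using hij
  have hfr : ∀ i, r (A.get i) (B.get (f i)) := fun i => by
    rw [← hg]
    exact List.Forall₂.get hl i.2 _
  refine ⟨fun j => if hj : ∃ i, f i = j then hj.choose else k j, fun i => ⟨f i, ?_⟩, fun j => ?_⟩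
  · have hj : ∃ i', f i' = f i := ⟨i, rfl⟩
    simp only [hj, dite_true]
    exact hf hj.choose_spec
  · by_cases hj : ∃ i, f i = j
    · simp only [hj, dite_true]
      have := hfr hj.choose
      rwa [hj.choose_spec] at this
    · simpa only [hj, dite_false] using hk j

theorem wellQuasiOrdered_surjRel_labelledLe {F ι : Type*} [Finite F] [Finite ι] :
    WellQuasiOrdered (List.SurjRel (LabelledLe (F := F) (ι := ι))) := by
  intro s
  obtain ⟨m, n, hmn, h⟩ := ((wellQuasiOrdered_smythRel_labelledLe (F := F) (ι := ι)).prod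
    wellQuasiOrdered_labelledLe.sublistForall₂).comap (fun A => (A, A)) s
  exact ⟨m, n, hmn, h.2.surjRel h.1⟩

/-- A code for an upper bound, faithful on `∞` and on bounds at most `B`. -/
def upperCode (B : ℕ) (x : ℕ∞) : Bool × Fin (B + 1) := (x = ⊤, Fin.ofNat (B + 1) x.toNat)

theorem upperCode_injOn (B : ℕ) : Set.InjOn (upperCode B) {x | x = ⊤ ∨ x ≤ B} := by
  intro x hx y hy h
  simp only [upperCode, Prod.mk.injEq, decide_eq_decide, Fin.ext_iff, Fin.val_ofNat] at h
  cases x <;> cases y <;> simp_all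
  rwa [Nat.mod_eq_of_lt (by omega), Nat.mod_eq_of_lt (by omega)] at h

/-- The part of a named gap ranging over a finite set. -/
def gapLabel {Var : Type*} (B : ℕ) (g : NamedGap Var) :
    Var × Option ((Bool × Fin (B + 1)) × (Bool × Fin (B + 1))) :=
  (g.1, g.2.map fun v => (upperCode B v.uw, upperCode B v.us))

/-- The lower bounds of a named gap. -/
def gapLower {Var : Type*} (g : NamedGap Var) : Bool → ℕ :=
  fun b => g.2.elim 0 fun v => if b then v.lw else v.ls

theorem GapVal.upper_mem {B : ℕ} {v : GapVal} (h : v.Free ∨ v.Bounded B) :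
    (v.uw = ⊤ ∨ v.uw ≤ B) ∧ (v.us = ⊤ ∨ v.us ≤ B) := by
  rcases h with h | h
  · exact ⟨.inl h.1, .inl h.2⟩
  · exact ⟨.inr h.1, .inr h.2⟩

theorem gapLe_of_gapLabel_eq {Var : Type*} (star : Var) {B : ℕ} {g g' : NamedGap Var}
    (hg : ∀ v, g.2 = some v → v.Free ∨ v.Bounded B)
    (hg' : ∀ v, g'.2 = some v → v.Free ∨ v.Bounded B)
    (hlabel : gapLabel B g = gapLabel B g') (hle : gapLower g ≤ gapLower g') :
    gapLe star g g' := by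
  obtain ⟨x, o⟩ := g
  obtain ⟨x', o'⟩ := g'
  simp only [gapLabel, Prod.mk.injEq] at hlabel
  obtain ⟨rfl, ho⟩ := hlabel
  refine ⟨fun h => (h rfl).elim, ?_, ?_⟩
  · cases o <;> cases o' <;> simp_all
  · rintro v v' rfl rfl
    simp only [Option.map_some, Option.some.injEq, Prod.mk.injEq] at ho
    have hv := GapVal.upper_mem (hg v rfl)
    have hv' := GapVal.upper_mem (hg' v' rfl)
    refine ⟨by simpa [gapLower] using hle true, by simpa [gapLower] using hle false, ?_, ?_⟩
    · exact (upperCode_injOn B hv.1 hv'.1 ho.1).ge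
    · exact (upperCode_injOn B hv.2 hv'.2 ho.2).ge

/-- The padding of a tuple of dimension `M` to dimension `K`. -/
def padTuple {α : Type*} {M : ℕ} (K : ℕ) (d : α) (x : Fin M → α) (j : Fin K) : α :=
  if h : j < M then x ⟨j, h⟩ else d

theorem padTuple_castLE {α : Type*} {M K : ℕ} (hM : M ≤ K) (d : α) (x : Fin M → α) (j : Fin M) :
    padTuple K d x (j.castLE hM) = x j := by
  simp [padTuple]

theorem padTuple_castLE_cast {α : Type*} {M M' K : ℕ} (hM : M ≤ K) (h : M = M') (d : α)
    (x : Fin M' → α) (j : Fin M) : padTuple K d x (j.castLE hM) = x (j.cast h) := by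
  subst h
  exact padTuple_castLE hM d x j

/-- A task state of dimension `M` as a labelled vector of dimension independent of `M`. -/
def taskCode {UnrSuff : Type u} {Var : Type v} (star : Var) (K B : ℕ) {M : ℕ}
    (a : TaskState UnrSuff Var M) :
    (UnrSuff × (Fin K → Var × Option ((Bool × Fin (B + 1)) × (Bool × Fin (B + 1))))) ×
      (Fin K × Bool → ℕ) :=
  ((a.1, fun j => gapLabel B (padTuple K (star, none) a.2 j)),
    fun p => gapLower (padTuple K (star, none) a.2 p.1) p.2)

theorem gapLe_of_labelledLe_taskCode {UnrSuff : Type u} {Var : Type v} (star : Var)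
    {K B M M' : ℕ} (hK : M ≤ K) (hM : M = M') {a : TaskState UnrSuff Var M}
    {a' : TaskState UnrSuff Var M'}
    (ha : ∀ j v, (a.2 j).2 = some v → v.Free ∨ v.Bounded B)
    (ha' : ∀ j v, (a'.2 j).2 = some v → v.Free ∨ v.Bounded B)
    (h : LabelledLe (taskCode star K B a) (taskCode star K B a')) :
    a.1 = a'.1 ∧ ∀ j, gapLe star (a.2 j) (a'.2 (j.cast hM)) := by
  obtain ⟨hlabel, hle⟩ := h
  simp only [taskCode, Prod.mk.injEq] at hlabel hle
  refine ⟨hlabel.1, fun j => gapLe_of_gapLabel_eq star (ha j) (ha' _) ?_ fun b => ?_⟩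
  · simpa only [padTuple_castLE, padTuple_castLE_cast hK hM] using
      congrFun hlabel.2 (j.castLE hK)
  · simpa only [padTuple_castLE, padTuple_castLE_cast hK hM] using hle (j.castLE hK, b)

/-- The relation `⊑ₑ` is a well-quasi-order on any
`K`-dimension-bounded set of `B`-good encodings. -/
theorem encodings_isWQO_encEntails {BV : Type u} {Var : Type v} {UnrSuff : Type w}
    [Fintype BV] [Fintype Var] [Fintype UnrSuff] (star : Var) (starU : UnrSuff)
    (K B : ℕ) (E : Set (Encoding BV Var UnrSuff))
    (hdim : ∀ e ∈ E, e.M ≤ K) (hgood : ∀ e ∈ E, EncodingBGood B e) :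
    IsWQOOn E (EncEntails star starU) := by
  intro s hs
  obtain ⟨m, n, hmn, hbv, hMod, henv, h, hsurj, hacc⟩ :=
    ((Finite.wellQuasiOrdered (α := BV → Option Bool) (· = ·)).prod
      ((Finite.wellQuasiOrdered (α := Fin (K + 1)) (· = ·)).prod
        ((wellQuasiOrdered_le (α := Fin K → ℕ × ℕ)).prod
          (wellQuasiOrdered_surjRel_labelledLe
            (F := UnrSuff × (Fin K → Var × Option ((Bool × Fin (B + 1)) × (Bool × Fin (B + 1)))))
            (ι := Fin K × Bool))))).comap
      (fun e : Encoding BV Var UnrSuff => (e.bv, Fin.ofNat (K + 1) e.M, padTuple K 0 e.env,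
        List.ofFn fun i => taskCode star K B (e.acc i))) s
  have hKm := hdim _ (hs m)
  have hKn := hdim _ (hs n)
  have hM : (s m).M = (s n).M := by
    simpa [Fin.ext_iff, Nat.mod_eq_of_lt (Nat.lt_succ_of_le hKm),
      Nat.mod_eq_of_lt (Nat.lt_succ_of_le hKn)] using hMod
  have hcode : ∀ i : Fin (s n).L, _ := fun i =>
    gapLe_of_labelledLe_taskCode star hKm hM
      (hgood _ (hs m) ((h (i.cast (by simp))).cast (by simp)))
      (hgood _ (hs n) i) (by simpa [Fin.cast] using hacc (i.cast (by simp)))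
  refine ⟨m, n, hmn, fun b hb => (hb (congrFun hbv b)).elim, hM,
    fun i => (h (i.cast (by simp))).cast (by simp), fun i => ?_,
    fun i => ⟨fun hne => (hne (hcode i).1).elim, (hcode i).2⟩, fun j => ?_⟩
  · obtain ⟨k, hk⟩ := hsurj (i.cast (by simp))
    exact ⟨k.cast (by simp), by simp [hk]⟩
  · simpa only [← Prod.le_def, padTuple_castLE, padTuple_castLE_cast hKm hM] using
      henv (j.castLE hKm)
end

section
/- Let φ and φ' be constraints with total orders <_T, <_P on the tasks and phasers of φ and <_{T'}, <_{P'} on those of φ'. If the encodings are equal, ⌈φ⌉ = ⌈φ'⌉, then φ ⊑ φ' and φ' ⊑ φ; consequently ⟦φ⟧ = ⟦φ'⟧. -/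
universe u v w

theorem IsEnum.exists_eq {S : Finset ℕ} {e : Fin S.card → ℕ} (he : IsEnum S e) {t : ℕ}
    (ht : t ∈ S) : ∃ i, e i = t := by
  have himg : Finset.univ.image e = S :=
    Finset.eq_of_subset_of_card_le (Finset.image_subset_iff.2 fun i _ => he.2 i)
      (by rw [Finset.card_image_of_injective _ he.1, Finset.card_univ, Fintype.card_fin])
  rw [← himg] at ht
  simpa using ht

/-- Enumerations of finite sets of equal cardinality induce an index-preserving bijection. -/
theorem IsEnum.exists_relabeling {S S' : Finset ℕ} {e : Fin S.card → ℕ} {e' : Fin S'.card → ℕ}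
    (he : IsEnum S e) (he' : IsEnum S' e') (h : S'.card = S.card) :
    ∃ f : ℕ → ℕ, Set.InjOn f ↑S' ∧ S'.image f = S ∧ ∀ i, f (e' i) = e (Fin.cast h i) := by
  have hf : ∀ i, Function.extend e' (e ∘ Fin.cast h) id (e' i) = e (Fin.cast h i) :=
    fun i => he'.1.extend_apply _ _ i
  refine ⟨Function.extend e' (e ∘ Fin.cast h) id, ?_, ?_, hf⟩
  · intro a ha b hb hab
    obtain ⟨i, rfl⟩ := he'.exists_eq ha
    obtain ⟨j, rfl⟩ := he'.exists_eq hb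
    rw [hf, hf] at hab
    rw [Fin.cast_injective h (he.1 hab)]
  · ext t
    simp only [Finset.mem_image]
    constructor
    · rintro ⟨a, ha, rfl⟩
      obtain ⟨i, rfl⟩ := he'.exists_eq ha
      rw [hf]
      exact he.2 _
    · intro ht
      obtain ⟨i, rfl⟩ := he.exists_eq ht
      exact ⟨e' (Fin.cast h.symm i), he'.2 _, by rw [hf]; rfl⟩

section

variable {BV : Type u} {Var : Type v} {UnrSuff : Type w}

/-- The constraint `φ'` becomes `φ` after renaming its tasks by `f` and its phasers by `g`. -/
structure IsRelabeling (φ φ' : Constraint BV Var UnrSuff) (f g : ℕ → ℕ) : Prop where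
  bv : φ.bv = φ'.bv
  image_T : φ'.T.image f = φ.T
  injOn_P : Set.InjOn g ↑φ'.P
  image_P : φ'.P.image g = φ.P
  seq : ∀ t ∈ φ'.T, φ.seq (f t) = φ'.seq t
  gap : ∀ t ∈ φ'.T, ∀ p ∈ φ'.P, φ.gap (f t) (g p) = φ'.gap t p
  egap : ∀ p ∈ φ'.P, φ.egap (g p) = φ'.egap p

theorem Encoding.components_eq {e e' : Encoding BV Var UnrSuff} (h : e = e') :
    ∃ (hL : e'.L = e.L) (hM : e'.M = e.M), e.bv = e'.bv ∧
      (∀ i, (e.acc (Fin.cast hL i)).1 = (e'.acc i).1) ∧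
      (∀ i j, (e.acc (Fin.cast hL i)).2 (Fin.cast hM j) = (e'.acc i).2 j) ∧
      ∀ j, e.env (Fin.cast hM j) = e'.env j := by
  subst h
  exact ⟨rfl, rfl, rfl, fun _ => rfl, fun _ _ => rfl, fun _ => rfl⟩

theorem exists_isRelabeling_of_encodingOf_eq {φ φ' : Constraint BV Var UnrSuff}
    {eT : Fin φ.T.card → ℕ} {eP : Fin φ.P.card → ℕ}
    {eT' : Fin φ'.T.card → ℕ} {eP' : Fin φ'.P.card → ℕ}
    (hT : IsEnum φ.T eT) (hP : IsEnum φ.P eP)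
    (hT' : IsEnum φ'.T eT') (hP' : IsEnum φ'.P eP')
    (heq : encodingOf φ eT eP = encodingOf φ' eT' eP') :
    ∃ f g, IsRelabeling φ φ' f g := by
  obtain ⟨hL, hM, hbv, hseq, hgap, henv⟩ := Encoding.components_eq heq
  obtain ⟨f, -, hfT, hf⟩ := hT.exists_relabeling hT' hL
  obtain ⟨g, hgi, hgP, hg⟩ := hP.exists_relabeling hP' hM
  refine ⟨f, g, hbv, hfT, hgi, hgP, ?_, ?_, ?_⟩
  · intro t ht
    obtain ⟨i, rfl⟩ := hT'.exists_eq ht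
    rw [hf]
    exact hseq i
  · intro t ht p hp
    obtain ⟨i, rfl⟩ := hT'.exists_eq ht
    obtain ⟨j, rfl⟩ := hP'.exists_eq hp
    rw [hf, hg]
    exact hgap i j
  · intro p hp
    obtain ⟨j, rfl⟩ := hP'.exists_eq hp
    rw [hg]
    exact henv j

theorem gapLe_refl (star : Var) (a : NamedGap Var) : gapLe star a a := by
  refine ⟨fun h => absurd rfl h, Iff.rfl, fun v v' h h' => ?_⟩
  obtain rfl : v = v' := Option.some.inj (h.symm.trans h')
  exact ⟨le_rfl, le_rfl, le_rfl, le_rfl⟩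

theorem IsRelabeling.entails {φ φ' : Constraint BV Var UnrSuff} {f g : ℕ → ℕ}
    (h : IsRelabeling φ φ' f g) (star : Var) (starU : UnrSuff) :
    Entails star starU φ φ' := by
  refine ⟨fun b hb => absurd (congrFun h.bv b) hb, φ'.T, subset_rfl, φ'.P, subset_rfl, f, g,
    h.image_T, h.injOn_P, h.image_P, fun t ht hne => absurd (h.seq t ht) hne, fun p hp => ?_⟩
  rw [h.egap p hp]
  refine ⟨⟨le_rfl, le_rfl⟩, fun t ht => ?_, fun t ht hn => absurd ht hn⟩
  rw [h.gap t ht p hp]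
  exact gapLe_refl star _

theorem IsRelabeling.denotes {φ φ' : Constraint BV Var UnrSuff} {f g : ℕ → ℕ}
    (h : IsRelabeling φ φ' f g) {star : Var} {starU : UnrSuff} {c : Config BV Var UnrSuff}
    (hc : Denotes star starU φ' c) : Denotes star starU φ c := by
  obtain ⟨hbv, T1, hT1, P1, hP1, τ, π, hτ, hπi, hπ, hseq, hgap⟩ := hc
  have memT : ∀ t ∈ T1, τ t ∈ φ'.T := fun t ht => hτ ▸ Finset.mem_image_of_mem τ ht
  have memP : ∀ p ∈ P1, π p ∈ φ'.P := fun p hp => hπ ▸ Finset.mem_image_of_mem π hp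
  refine ⟨h.bv ▸ hbv, T1, hT1, P1, hP1, f ∘ τ, g ∘ π, ?_, h.injOn_P.comp hπi memP, ?_,
    fun t ht => ?_, fun p hp => ?_⟩
  · rw [← Finset.image_image, hτ, h.image_T]
  · rw [← Finset.image_image, hπ, h.image_P]
  · rw [Function.comp_apply, h.seq _ (memT t ht)]
    exact hseq t ht
  · obtain ⟨l, hl, hl'⟩ := hgap p hp
    refine ⟨l, fun t ht => ?_, ?_⟩
    · rw [Function.comp_apply, Function.comp_apply, h.gap _ (memT t ht) _ (memP p hp)]
      exact hl t ht
    · rw [Function.comp_apply, h.egap _ (memP p hp)]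
      exact hl'

end

/-- If two constraints have equal encodings (w.r.t. total orders
on their tasks and phasers), then they entail each other and hence have the
same denotation. -/
theorem equal_encodings_mutual_entailment {BV : Type u} {Var : Type v} {UnrSuff : Type w}
    (star : Var) (starU : UnrSuff) (φ φ' : Constraint BV Var UnrSuff)
    (eT : Fin φ.T.card → ℕ) (eP : Fin φ.P.card → ℕ)
    (eT' : Fin φ'.T.card → ℕ) (eP' : Fin φ'.P.card → ℕ)
    (hT : IsEnum φ.T eT) (hP : IsEnum φ.P eP)
    (hT' : IsEnum φ'.T eT') (hP' : IsEnum φ'.P eP')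
    (heq : encodingOf φ eT eP = encodingOf φ' eT' eP') :
    Entails star starU φ φ' ∧ Entails star starU φ' φ ∧
      Denotation star starU φ = Denotation star starU φ' := by
  obtain ⟨f, g, h⟩ := exists_isRelabeling_of_encodingOf_eq hT hP hT' hP' heq
  obtain ⟨f', g', h'⟩ := exists_isRelabeling_of_encodingOf_eq hT' hP' hT hP heq.symm
  exact ⟨h.entails star starU, h'.entails star starU,
    Set.ext fun _ => ⟨h'.denotes, h.denotes⟩⟩
end
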